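/- Let k be a field of characteristic zero and let A and B be commutative k-algebras. Then the following are equivalent: (i) the images of ML(A) and ML(B) under the canonical inclusions A → A ⊗_k B and B → A ⊗_k B are both contained in ML(A ⊗_k B); (ii) ML(A ⊗_k B) = ML(A) ⊗_k ML(B) (as subalgebras of A ⊗_k B). -/

import Mathlib

/-- A derivation `D` is locally nilpotent if for every `a` some positive iterate of `D`
kills `a`. -/
def Derivation.IsLocallyNilpotent {k A : Type*} [CommRing k] [CommRing A] [Algebra k A]
    (D : Derivation k A A) : Prop :=
  ∀ a : A, ∃ n : ℕ, 0 < n ∧ (⇑D)^[n] a = 0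

/-- The kernel of a derivation `D : A → A`, as a `k`-subalgebra of `A`. -/
def Derivation.kerSubalgebra {k A : Type*} [CommRing k] [CommRing A] [Algebra k A]
    (D : Derivation k A A) : Subalgebra k A where
  carrier := {a : A | D a = 0}
  add_mem' := by
    intro a b ha hb
    simp only [Set.mem_setOf_eq] at *
    rw [map_add, ha, hb, add_zero]
  mul_mem' := by
    intro a b ha hb
    simp only [Set.mem_setOf_eq] at *
    rw [Derivation.leibniz, ha, hb, smul_zero, smul_zero, add_zero]
  algebraMap_mem' := fun r => by
    simp only [Set.mem_setOf_eq, Derivation.map_algebraMap]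

/-- The Makar-Limanov invariant of a commutative `k`-algebra `A`: the intersection of the
kernels of all locally nilpotent `k`-derivations of `A`. -/
def MakarLimanov (k A : Type*) [CommRing k] [CommRing A] [Algebra k A] : Subalgebra k A :=
  ⨅ D : {D : Derivation k A A // D.IsLocallyNilpotent}, (D : Derivation k A A).kerSubalgebra

open TensorProduct in
/-- A tensor killed by all `id ⊗ f i` comes from the common kernel of the `f i`. -/
theorem TensorProduct.mem_range_lTensor_iInf_ker {k M N P ι : Type*} [Field k]
    [AddCommGroup M] [Module k M] [AddCommGroup N] [Module k N] [AddCommGroup P] [Module k P]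
    (f : ι → N →ₗ[k] P) (x : M ⊗[k] N) (hx : ∀ i, (f i).lTensor M x = 0) :
    x ∈ LinearMap.range ((⨅ i, LinearMap.ker (f i)).subtype.lTensor M) := by
  classical
  let b := Module.Basis.ofVectorSpace k M
  have key (i) (j) (y : M ⊗[k] N) : TensorProduct.equivFinsuppOfBasisLeft b ((f i).lTensor M y) j =
      f i (TensorProduct.equivFinsuppOfBasisLeft b y j) := by
    induction y with
    | zero => simp
    | tmul m n => simp
    | add y z hy hz => simp [hy, hz]
  rw [← (TensorProduct.equivFinsuppOfBasisLeft b).symm_apply_apply x,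
    TensorProduct.equivFinsuppOfBasisLeft_symm_apply]
  refine Submodule.sum_mem _ fun j _ => ?_
  have hmem : TensorProduct.equivFinsuppOfBasisLeft b x j ∈ ⨅ i, LinearMap.ker (f i) := by
    simp only [Submodule.mem_iInf, LinearMap.mem_ker]
    intro i
    rw [← key, hx, map_zero, Finsupp.zero_apply]
  exact ⟨b j ⊗ₜ ⟨_, hmem⟩, by simp⟩

open TensorProduct in
/-- A tensor killed by all `f i ⊗ id` and all `id ⊗ g j` comes from the tensor product of the
common kernels. -/
theorem TensorProduct.mem_range_map_iInf_ker {k M M' N N' ι κ : Type*} [Field k]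
    [AddCommGroup M] [Module k M] [AddCommGroup M'] [Module k M']
    [AddCommGroup N] [Module k N] [AddCommGroup N'] [Module k N']
    (f : ι → M →ₗ[k] M') (g : κ → N →ₗ[k] N') (x : M ⊗[k] N)
    (hf : ∀ i, (f i).rTensor N x = 0) (hg : ∀ j, (g j).lTensor M x = 0) :
    x ∈ LinearMap.range (TensorProduct.map (⨅ i, LinearMap.ker (f i)).subtype
      (⨅ j, LinearMap.ker (g j)).subtype) := by
  obtain ⟨y, rfl⟩ := mem_range_lTensor_iInf_ker g x hg
  clear hg
  generalize (⨅ j, LinearMap.ker (g j)) = T at y hf ⊢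
  have hinj : Function.Injective (T.subtype.lTensor M') :=
    Module.Flat.lTensor_preserves_injective_linearMap _ T.injective_subtype
  have hy (i) : (f i).lTensor T (TensorProduct.comm k M T y) = 0 := by
    rw [← LinearMap.comm_comp_rTensor_comp_comm_eq]
    have : (f i).rTensor T y = 0 := hinj <| by
      rw [map_zero, ← hf i, ← LinearMap.comp_apply, ← LinearMap.comp_apply,
        LinearMap.lTensor_comp_rTensor, LinearMap.rTensor_comp_lTensor]
    simp [this]
  obtain ⟨z, hz⟩ := mem_range_lTensor_iInf_ker f _ hy
  refine ⟨TensorProduct.comm k _ _ z, ?_⟩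
  have : y = (TensorProduct.comm k M T).symm
      ((⨅ i, LinearMap.ker (f i)).subtype.lTensor T z) := by rw [hz]; simp
  rw [this]
  clear this hz hy hf
  induction z with
  | zero => simp
  | tmul => simp
  | add a b ha hb => simp only [map_add, ha, hb]

namespace Derivation

open TensorProduct

/-- The derivation `D ⊗ id` of `A ⊗ B`. -/
noncomputable def rTensor {k A : Type*} (B : Type*) [CommRing k] [CommRing A] [Algebra k A]
    [CommRing B] [Algebra k B] (D : Derivation k A A) :
    Derivation k (A ⊗[k] B) (A ⊗[k] B) :=
  Derivation.mk' ((D : A →ₗ[k] A).rTensor B) fun x y => by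
    induction x with
    | zero => simp
    | add x x' hx hx' => simp only [add_mul, map_add, hx, hx', smul_add, add_smul]; abel
    | tmul a b =>
      induction y with
      | zero => simp
      | add y y' hy hy' => simp only [mul_add, map_add, hy, hy', smul_add, add_smul]; abel
      | tmul a' b' => simp [add_tmul, mul_comm b]

/-- The derivation `id ⊗ D` of `A ⊗ B`. -/
noncomputable def lTensor {k B : Type*} (A : Type*) [CommRing k] [CommRing A] [Algebra k A]
    [CommRing B] [Algebra k B] (D : Derivation k B B) :
    Derivation k (A ⊗[k] B) (A ⊗[k] B) :=
  Derivation.mk' ((D : B →ₗ[k] B).lTensor A) fun x y => by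
    induction x with
    | zero => simp
    | add x x' hx hx' => simp only [add_mul, map_add, hx, hx', smul_add, add_smul]; abel
    | tmul a b =>
      induction y with
      | zero => simp
      | add y y' hy hy' => simp only [mul_add, map_add, hy, hy', smul_add, add_smul]; abel
      | tmul a' b' => simp [tmul_add, mul_comm a]

section

variable {k A B : Type*} [CommRing k] [CommRing A] [Algebra k A] [CommRing B] [Algebra k B]

theorem rTensor_apply (D : Derivation k A A) (x : A ⊗[k] B) :
    D.rTensor B x = (D : A →ₗ[k] A).rTensor B x := rfl

theorem lTensor_apply (D : Derivation k B B) (x : A ⊗[k] B) :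
    D.lTensor A x = (D : B →ₗ[k] B).lTensor A x := rfl

/-- A derivation of `A ⊗ B` is locally nilpotent as soon as it is nilpotent at pure tensors. -/
theorem isLocallyNilpotent_of_tmul (D : Derivation k (A ⊗[k] B) (A ⊗[k] B))
    (h : ∀ a b, ∃ n : ℕ, 0 < n ∧ (⇑D)^[n] (a ⊗ₜ[k] b) = 0) : D.IsLocallyNilpotent := by
  intro x
  induction x with
  | zero => exact ⟨1, one_pos, by simp⟩
  | tmul a b => exact h a b
  | add x y hx hy =>
    obtain ⟨n, hn, hx⟩ := hx
    obtain ⟨m, hm, hy⟩ := hy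
    refine ⟨n + m, by omega, ?_⟩
    rw [iterate_map_add, Function.iterate_add_apply _ n m y, hy, add_comm n m,
      Function.iterate_add_apply, hx, iterate_map_zero, iterate_map_zero, add_zero]

theorem IsLocallyNilpotent.rTensor {D : Derivation k A A} (hD : D.IsLocallyNilpotent) :
    (D.rTensor B).IsLocallyNilpotent := by
  refine isLocallyNilpotent_of_tmul _ fun a b => ?_
  obtain ⟨n, hn, h⟩ := hD a
  have hs : Function.Semiconj (fun a : A => a ⊗ₜ[k] b) D (D.rTensor B) := fun a => by
    simp [rTensor_apply]
  exact ⟨n, hn, by rw [← hs.iterate_right n a, h]; exact zero_tmul _ _⟩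

theorem IsLocallyNilpotent.lTensor {D : Derivation k B B} (hD : D.IsLocallyNilpotent) :
    (D.lTensor A).IsLocallyNilpotent := by
  refine isLocallyNilpotent_of_tmul _ fun a b => ?_
  obtain ⟨n, hn, h⟩ := hD b
  have hs : Function.Semiconj (fun b : B => a ⊗ₜ[k] b) D (D.lTensor A) := fun b => by
    simp [lTensor_apply]
  exact ⟨n, hn, by rw [← hs.iterate_right n b, h]; exact tmul_zero _ _⟩

end

end Derivation

theorem mem_makarLimanov {k A : Type*} [CommRing k] [CommRing A] [Algebra k A] {a : A} :
    a ∈ MakarLimanov k A ↔ ∀ D : Derivation k A A, D.IsLocallyNilpotent → D a = 0 := by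
  simp only [MakarLimanov, Algebra.mem_iInf, Subtype.forall]
  rfl

theorem mem_makarLimanov_of_mem_iInf_ker {k A : Type*} [CommRing k] [CommRing A] [Algebra k A]
    {a : A} (ha : a ∈ ⨅ D : {D : Derivation k A A // D.IsLocallyNilpotent},
      LinearMap.ker (D.1 : A →ₗ[k] A)) : a ∈ MakarLimanov k A := by
  simpa [mem_makarLimanov, Submodule.mem_iInf] using ha

open TensorProduct in
theorem makarLimanov_tensor_le (k A B : Type*) [Field k]
    [CommRing A] [Algebra k A] [CommRing B] [Algebra k B] :
    MakarLimanov k (A ⊗[k] B) ≤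
      (MakarLimanov k A).map
          (Algebra.TensorProduct.includeLeft : A →ₐ[k] A ⊗[k] B) ⊔
        (MakarLimanov k B).map
          (Algebra.TensorProduct.includeRight : B →ₐ[k] A ⊗[k] B) := by
  intro x hx
  rw [mem_makarLimanov] at hx
  obtain ⟨y, rfl⟩ := TensorProduct.mem_range_map_iInf_ker
    (fun D : {D : Derivation k A A // D.IsLocallyNilpotent} => (D.1 : A →ₗ[k] A))
    (fun D : {D : Derivation k B B // D.IsLocallyNilpotent} => (D.1 : B →ₗ[k] B)) x
    (fun D => hx _ D.2.rTensor) (fun D => hx _ D.2.lTensor)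
  clear hx
  induction y with
  | zero => rw [map_zero]; exact zero_mem _
  | add y z hy hz => rw [map_add]; exact add_mem hy hz
  | tmul a b =>
    have : (a : A) ⊗ₜ[k] (b : B) = Algebra.TensorProduct.includeLeft (S := k) (a : A) *
        Algebra.TensorProduct.includeRight (b : B) := by simp
    rw [TensorProduct.map_tmul, Submodule.subtype_apply, Submodule.subtype_apply, this]
    exact mul_mem
      (le_sup_left (a := (MakarLimanov k A).map _)
        ⟨a, mem_makarLimanov_of_mem_iInf_ker a.2, rfl⟩)
      (le_sup_right (b := (MakarLimanov k B).map _)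
        ⟨b, mem_makarLimanov_of_mem_iInf_ker b.2, rfl⟩)

open TensorProduct in
theorem makarLimanov_tensor_eq_iff (k A B : Type*) [Field k] [CharZero k]
    [CommRing A] [Algebra k A] [CommRing B] [Algebra k B] :
    ((MakarLimanov k A).map
          (Algebra.TensorProduct.includeLeft : A →ₐ[k] A ⊗[k] B) ≤
        MakarLimanov k (A ⊗[k] B) ∧
      (MakarLimanov k B).map
          (Algebra.TensorProduct.includeRight : B →ₐ[k] A ⊗[k] B) ≤
        MakarLimanov k (A ⊗[k] B)) ↔
      MakarLimanov k (A ⊗[k] B) =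
        (MakarLimanov k A).map
            (Algebra.TensorProduct.includeLeft : A →ₐ[k] A ⊗[k] B) ⊔
          (MakarLimanov k B).map
            (Algebra.TensorProduct.includeRight : B →ₐ[k] A ⊗[k] B) := by
  rw [← sup_le_iff]
  exact ⟨fun h => le_antisymm (makarLimanov_tensor_le k A B) h, fun h => h.ge⟩
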